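/- arXiv:2405.03559 — 3 statements merged into one kernel-verified Lean document; each statement's English description precedes it below -/
import Mathlib

section
/- Let n ≥ 1, let f, g : Fin n → Fin 4, and let α, β be complex numbers with α, β ∈ {1, −1, i, −i}. Suppose there exists a nonzero vector ψ : (Fin n → Fin 2) → ℂ with (α • P f).mulVec ψ = ψ and (β • P g).mulVec ψ = ψ, i.e. both Pauli operators stabilize ψ. Then α • P f and β • P g commute: (α • P f) * (β • P g) = (β • P g) * (α • P f). -/
open scoped BigOperators

/-- The single-qubit Pauli matrices `I, X, Y, Z`. -/
noncomputable def pauliSigma : Fin 4 → Matrix (Fin 2) (Fin 2) ℂ :=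
  ![1, !![0, 1; 1, 0], !![0, -Complex.I; Complex.I, 0], !![1, 0; 0, -1]]

/-- The `n`-fold Kronecker product `⊗ᵢ σ_{f i}` of single-qubit Pauli matrices, realized
as a matrix indexed by functions `Fin n → Fin 2`. -/
noncomputable def pauliTensor (n : ℕ) (f : Fin n → Fin 4) :
    Matrix (Fin n → Fin 2) (Fin n → Fin 2) ℂ :=
  Matrix.of fun a b => ∏ i, pauliSigma (f i) (a i) (b i)

theorem exists_pauliSigma_mul_eq_smul_mul (a b : Fin 4) :
    ∃ c : ℂ, pauliSigma a * pauliSigma b = c • (pauliSigma b * pauliSigma a) := by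
  have h : pauliSigma a * pauliSigma b = (1 : ℂ) • (pauliSigma b * pauliSigma a) ∨
      pauliSigma a * pauliSigma b = (-1 : ℂ) • (pauliSigma b * pauliSigma a) := by
    fin_cases a <;> fin_cases b <;> simp [pauliSigma]
  exact h.elim (fun h => ⟨1, h⟩) fun h => ⟨-1, h⟩

theorem pauliTensor_mul_apply (n : ℕ) (f g : Fin n → Fin 4) (a b : Fin n → Fin 2) :
    (pauliTensor n f * pauliTensor n g) a b =
      ∏ i, (pauliSigma (f i) * pauliSigma (g i)) (a i) (b i) := by
  simp only [Matrix.mul_apply, pauliTensor, Matrix.of_apply, ← Finset.prod_mul_distrib]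
  rw [Finset.prod_univ_sum, Fintype.piFinset_univ]

theorem exists_pauliTensor_mul_eq_smul_mul (n : ℕ) (f g : Fin n → Fin 4) :
    ∃ c : ℂ, pauliTensor n f * pauliTensor n g = c • (pauliTensor n g * pauliTensor n f) := by
  choose c hc using fun i => exists_pauliSigma_mul_eq_smul_mul (f i) (g i)
  refine ⟨∏ i, c i, ?_⟩
  ext a b
  simp only [Matrix.smul_apply, pauliTensor_mul_apply, hc, smul_eq_mul, Finset.prod_mul_distrib]

theorem Matrix.commute_of_mulVec_eq_self {m K : Type*} [Fintype m] [Field K]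
    {A B : Matrix m m K} {c : K} (hAB : A * B = c • (B * A)) {ψ : m → K} (hψ : ψ ≠ 0)
    (hA : A.mulVec ψ = ψ) (hB : B.mulVec ψ = ψ) : A * B = B * A := by
  have h : (A * B).mulVec ψ = c • (B * A).mulVec ψ := by rw [hAB, Matrix.smul_mulVec]
  rw [← Matrix.mulVec_mulVec, ← Matrix.mulVec_mulVec, hA, hB, hA] at h
  have hc : c = 1 := smul_left_injective K hψ (by simpa using h.symm)
  rw [hAB, hc, one_smul]

/-- Two elements of the `n`-qubit Pauli group that both stabilize a common nonzero state
must commute. -/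
theorem pauli_stabilizers_commute (n : ℕ) (hn : 1 ≤ n) (f g : Fin n → Fin 4) (α β : ℂ)
    (hα : α ∈ ({1, -1, Complex.I, -Complex.I} : Set ℂ))
    (hβ : β ∈ ({1, -1, Complex.I, -Complex.I} : Set ℂ))
    (ψ : (Fin n → Fin 2) → ℂ) (hψ : ψ ≠ 0)
    (hfψ : (α • pauliTensor n f).mulVec ψ = ψ)
    (hgψ : (β • pauliTensor n g).mulVec ψ = ψ) :
    (α • pauliTensor n f) * (β • pauliTensor n g) =
      (β • pauliTensor n g) * (α • pauliTensor n f) := by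
  obtain ⟨c, hc⟩ := exists_pauliTensor_mul_eq_smul_mul n f g
  refine Matrix.commute_of_mulVec_eq_self (c := c) ?_ hψ hfψ hgψ
  rw [smul_mul_smul_comm, smul_mul_smul_comm, hc, smul_comm, mul_comm α β]
end

section
/- Let C be a chain complex of free ℤ-modules indexed by ℕ, let R be a commutative ring, and let n ∈ ℕ. If the n-th homology H_n(C) is a free ℤ-module, then the (n+1)-st homology of the complex C ⊗_ℤ R (with components C_k ⊗_ℤ R and differentials ∂_k ⊗ id_R) is isomorphic, as an R-module, to H_{n+1}(C) ⊗_ℤ R. -/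
open TensorProduct

section ChainComplexDefs

variable {R : Type*} [CommRing R] {C : ℕ → Type*}
  [∀ k, AddCommGroup (C k)] [∀ k, Module R (C k)]

/-- The submodule of `n`-cycles of a chain complex given by modules `C k` and
differentials `d k : C (k+1) →ₗ C k` (so that `∂_{k+1} = d k`, and `∂_0 = 0` since
`C_{-1} = 0`): at degree `0` it is everything, and at degree `k+1` it is `ker ∂_{k+1}`. -/
def chainCycles (d : ∀ k, C (k + 1) →ₗ[R] C k) : ∀ n, Submodule R (C n)
  | 0 => ⊤
  | (k + 1) => LinearMap.ker (d k)

/-- The `n`-th homology `H_n = ker ∂_n / im ∂_{n+1}` of the chain complex with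
differentials `d k : C (k+1) →ₗ C k`. -/
abbrev chainHomology (d : ∀ k, C (k + 1) →ₗ[R] C k) (n : ℕ) :=
  ↥(chainCycles d n) ⧸
    (LinearMap.range (d n)).comap (chainCycles d n).subtype

end ChainComplexDefs

section Hereditary

variable {A : Type*} [CommRing A] [IsPrincipalIdealRing A]

/-- Over a principal ideal ring, divisible modules satisfy Baer's criterion. -/
theorem Module.Baer.of_exists_smul_eq {E : Type*} [AddCommGroup E] [Module A E]
    (h : ∀ a : A, a ≠ 0 → ∀ x : E, ∃ y, a • y = x) : Module.Baer A E := fun I g ↦ by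
  obtain ⟨a, rfl⟩ := IsPrincipalIdealRing.principal I
  obtain rfl | ha := eq_or_ne a 0
  · refine ⟨0, fun x hx ↦ ?_⟩
    rw [Submodule.span_zero_singleton] at hx
    subst hx
    exact (map_zero g).symm
  · obtain ⟨y, hy⟩ := h a ha (g ⟨a, Submodule.mem_span_singleton_self a⟩)
    refine ⟨LinearMap.toSpanSingleton A E y, fun x hx ↦ ?_⟩
    obtain ⟨b, rfl⟩ := Submodule.mem_span_singleton.mp hx
    rw [LinearMap.toSpanSingleton_apply, smul_assoc, hy, ← map_smul, SetLike.mk_smul_mk]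

/-- Principal ideal domains are hereditary: submodules of projective modules are projective. -/
theorem Submodule.projective_of_isPrincipalIdealRing [IsDomain A] {P : Type*} [AddCommGroup P]
    [Module A P] [Module.Projective A P] (S : Submodule A P) : Module.Projective A S := by
  refine .of_lifting_property'' fun f hf ↦ ?_
  let j : (S →₀ A) →ₗ[A] (S →₀ FractionRing A) :=
    Finsupp.mapRange.linearMap (Algebra.linearMap A (FractionRing A))
  have hj : Function.Injective j :=
    Finsupp.mapRange_injective _ (map_zero _) (IsFractionRing.injective A (FractionRing A))
  let L := (LinearMap.ker f).map j
  have hbaer : Module.Baer A ((S →₀ FractionRing A) ⧸ L) := by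
    refine .of_exists_smul_eq fun a ha x ↦ ?_
    obtain ⟨x, rfl⟩ := L.mkQ_surjective x
    refine ⟨L.mkQ ((algebraMap A (FractionRing A) a)⁻¹ • x), ?_⟩
    rw [← map_smul, ← algebraMap_smul (FractionRing A) a (_ • x), smul_inv_smul₀]
    simpa using ha
  let φ : S →ₗ[A] (S →₀ FractionRing A) ⧸ L :=
    (LinearMap.ker f).mapQ L j (Submodule.le_comap_map _ _) ∘ₗ
      (f.quotKerEquivOfSurjective hf).symm.toLinearMap
  have hφ (x : S →₀ A) : φ (f x) = L.mkQ (j x) := by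
    have : (f.quotKerEquivOfSurjective hf).symm (f x) = (LinearMap.ker f).mkQ x := by
      rw [LinearEquiv.symm_apply_eq]; rfl
    simp only [φ, LinearMap.comp_apply, LinearEquiv.coe_coe, this]
    rfl
  obtain ⟨Φ, hΦ⟩ := hbaer.extension_property S.subtype S.injective_subtype φ
  obtain ⟨Ψ, hΨ⟩ := Module.projective_lifting_property L.mkQ Φ L.mkQ_surjective
  have key (s : S) : ∃ x, j x = Ψ s ∧ f x = s := by
    obtain ⟨x, rfl⟩ := hf s
    have h : L.mkQ (Ψ (f x)) = L.mkQ (j x) := by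
      rw [← hφ, ← hΦ, ← hΨ]; rfl
    obtain ⟨y, hy, hyx⟩ := (Submodule.Quotient.eq L).mp h
    refine ⟨y + x, by rw [map_add, hyx, sub_add_cancel], ?_⟩
    rw [map_add, LinearMap.mem_ker.mp hy, zero_add]
  choose h hjh hfh using key
  refine ⟨⟨⟨h, fun s t ↦ hj ?_⟩, fun a s ↦ hj ?_⟩, LinearMap.ext hfh⟩
  · simp [hjh]
  · simp [hjh]

end Hereditary

section Splitting

variable {A : Type*} [CommRing A] {M N : Type*} [AddCommGroup M] [Module A M]
  [AddCommGroup N] [Module A N]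

theorem Submodule.exists_retraction_of_projective_quotient (B : Submodule A N)
    [Module.Projective A (N ⧸ B)] : ∃ q : N →ₗ[A] B, ∀ b : B, q b = b := by
  obtain ⟨s, hs⟩ := Module.projective_lifting_property B.mkQ .id B.mkQ_surjective
  have hmem (x : N) : x - s (B.mkQ x) ∈ B := by
    rw [← Submodule.Quotient.mk_eq_zero, Submodule.Quotient.mk_sub, sub_eq_zero]
    exact (LinearMap.congr_fun hs (B.mkQ x)).symm
  refine ⟨(LinearMap.id - s ∘ₗ B.mkQ).codRestrict B hmem, fun b ↦ Subtype.ext ?_⟩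
  have : B.mkQ (b : N) = 0 := by simp
  simp [this]

/-- A linear map with projective image that factors through a chain of submodules
`range f ≤ Z ≤ N` with projective quotients has a generalized inverse. -/
theorem LinearMap.exists_comp_comp_self_eq (f : M →ₗ[A] N) (Z : Submodule A N)
    (hZ : LinearMap.range f ≤ Z) (hrange : Module.Projective A (LinearMap.range f))
    (hquot : Module.Projective A (N ⧸ Z))
    (hhom : Module.Projective A (Z ⧸ (LinearMap.range f).comap Z.subtype)) :
    ∃ r : N →ₗ[A] M, f ∘ₗ r ∘ₗ f = f := by
  obtain ⟨q, hq⟩ := Z.exists_retraction_of_projective_quotient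
  obtain ⟨p, hp⟩ :=
    ((LinearMap.range f).comap Z.subtype).exists_retraction_of_projective_quotient
  obtain ⟨s, hs⟩ := Module.projective_lifting_property f.rangeRestrict .id
    f.surjective_rangeRestrict
  let t : (LinearMap.range f).comap Z.subtype →ₗ[A] LinearMap.range f :=
    Z.subtype.restrict fun _ hx ↦ hx
  refine ⟨s ∘ₗ t ∘ₗ p ∘ₗ q, LinearMap.ext fun x ↦ ?_⟩
  have hx : t (p (q (f x))) = f.rangeRestrict x := by
    have h₁ : q (f x) = ⟨f x, hZ ⟨x, rfl⟩⟩ := hq ⟨f x, hZ ⟨x, rfl⟩⟩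
    have h₂ := hp ⟨⟨f x, hZ ⟨x, rfl⟩⟩, ⟨x, rfl⟩⟩
    rw [h₁, h₂]
    rfl
  have := congrArg Subtype.val (LinearMap.congr_fun hs (f.rangeRestrict x))
  simpa [hx] using this

/-- A linear map `π` out of the middle term of `L → M → N` that maps the cycles onto `Q`, with
the boundaries as kernel, identifies the homology with `Q`. -/
theorem nonempty_homology_equiv_of_surjective {L Q : Type*} [AddCommGroup L] [Module A L]
    [AddCommGroup Q] [Module A Q] (g : L →ₗ[A] M) (f : M →ₗ[A] N) (π : M →ₗ[A] Q)
    (hsurj : ∀ y, ∃ x, f x = 0 ∧ π x = y)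
    (hker : ∀ x, f x = 0 → (π x = 0 ↔ x ∈ LinearMap.range g)) :
    Nonempty ((LinearMap.ker f ⧸ (LinearMap.range g).comap (LinearMap.ker f).subtype) ≃ₗ[A] Q) := by
  have hF : Function.Surjective (π ∘ₗ (LinearMap.ker f).subtype) := fun y ↦ by
    obtain ⟨x, hx, hxy⟩ := hsurj y
    exact ⟨⟨x, hx⟩, hxy⟩
  refine ⟨(Submodule.quotEquivOfEq _ _ ?_).trans (LinearMap.quotKerEquivOfSurjective _ hF)⟩
  ext ⟨x, hx⟩
  exact (hker x hx).symm

/-- If the second map of `L → M → N` has a generalized inverse, then the cycles of the base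
change surject onto the base change of the homology, with the boundaries as kernel. -/
theorem exists_baseChange_homology_projection {L : Type*} [AddCommGroup L] [Module A L]
    (g : L →ₗ[A] M) (f : M →ₗ[A] N) (hfg : f ∘ₗ g = 0) (r : N →ₗ[A] M)
    (hr : f ∘ₗ r ∘ₗ f = f) (R : Type*) [CommRing R] [Algebra A R] :
    ∃ π : R ⊗[A] M →ₗ[R]
        R ⊗[A] (LinearMap.ker f ⧸ (LinearMap.range g).comap (LinearMap.ker f).subtype),
      (∀ y, ∃ x, f.baseChange R x = 0 ∧ π x = y) ∧
      ∀ x, f.baseChange R x = 0 → (π x = 0 ↔ x ∈ LinearMap.range (g.baseChange R)) := by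
  let i := (LinearMap.ker f).subtype
  let B := (LinearMap.range g).comap i
  let p : M →ₗ[A] LinearMap.ker f := (LinearMap.id - r ∘ₗ f).codRestrict _ fun x ↦ by
    simpa [sub_eq_zero] using (LinearMap.congr_fun hr x).symm
  let g' : L →ₗ[A] LinearMap.ker f := g.codRestrict _ (LinearMap.congr_fun hfg)
  have hpi : p ∘ₗ i = .id := by
    ext x
    simp [p, i]
  have hip : i ∘ₗ p + r ∘ₗ f = .id := by
    ext x
    simp [p, i]
  have hfi : f ∘ₗ i = 0 := LinearMap.ext fun x ↦ x.2
  have hpg : p ∘ₗ g = g' := by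
    ext x
    have : f (g x) = 0 := LinearMap.congr_fun hfg x
    change g x - r (f (g x)) = g x
    rw [this, map_zero, sub_zero]
  have hig : i ∘ₗ g' = g := rfl
  have hexact : Function.Exact g' B.mkQ := by
    rw [LinearMap.exact_iff, Submodule.ker_mkQ]
    ext x
    simp only [B, Submodule.mem_comap, LinearMap.mem_range]
    exact exists_congr fun y ↦ (Subtype.ext_iff (a1 := g' y) (a2 := x)).symm
  have hexactR : Function.Exact (g'.baseChange R) (B.mkQ.baseChange R) :=
    lTensor_exact R hexact B.mkQ_surjective
  refine ⟨B.mkQ.baseChange R ∘ₗ p.baseChange R, fun y ↦ ?_, fun x hx ↦ ?_⟩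
  · obtain ⟨z, rfl⟩ := LinearMap.baseChange_surjective R B.mkQ_surjective y
    refine ⟨i.baseChange R z, ?_, ?_⟩
    · rw [← LinearMap.comp_apply, ← LinearMap.baseChange_comp, hfi]
      simp
    · rw [LinearMap.comp_apply, ← LinearMap.comp_apply (p.baseChange R),
        ← LinearMap.baseChange_comp, hpi]
      simp
  · rw [LinearMap.comp_apply, hexactR (p.baseChange R x), LinearMap.mem_range]
    refine exists_congr fun y ↦ ⟨fun h ↦ ?_, fun h ↦ ?_⟩
    · have := LinearMap.congr_fun (congrArg (LinearMap.baseChange R) hip) x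
      rw [LinearMap.baseChange_add, LinearMap.baseChange_comp, LinearMap.baseChange_comp] at this
      simp only [LinearMap.add_apply, LinearMap.comp_apply, hx, ← h, map_zero,
        add_zero, LinearMap.baseChange_id, LinearMap.id_apply] at this
      rw [← this, ← LinearMap.comp_apply, ← LinearMap.baseChange_comp, hig]
    · rw [← h, ← hpg, LinearMap.baseChange_comp, LinearMap.comp_apply]

end Splitting

theorem range_le_chainCycles {R : Type*} [CommRing R] {C : ℕ → Type*}
    [∀ k, AddCommGroup (C k)] [∀ k, Module R (C k)] (d : ∀ k, C (k + 1) →ₗ[R] C k)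
    (hd : ∀ k, d k ∘ₗ d (k + 1) = 0) : ∀ n, LinearMap.range (d n) ≤ chainCycles d n
  | 0 => le_top
  | k + 1 => LinearMap.range_le_ker_iff.mpr (hd k)

theorem projective_quotient_chainCycles {R : Type*} [CommRing R] [IsDomain R]
    [IsPrincipalIdealRing R] {C : ℕ → Type*} [∀ k, AddCommGroup (C k)] [∀ k, Module R (C k)]
    [∀ k, Module.Projective R (C k)] (d : ∀ k, C (k + 1) →ₗ[R] C k) :
    ∀ n, Module.Projective R (C n ⧸ chainCycles d n)
  | 0 => by
    have : Subsingleton (C 0 ⧸ chainCycles d 0) :=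
      Submodule.Quotient.subsingleton_iff.mpr rfl
    infer_instance
  | k + 1 => by
    have := (LinearMap.range (d k)).projective_of_isPrincipalIdealRing
    exact .of_equiv (d k).quotKerEquivRange.symm


/-- Projectivity of an additive group does not depend on its `ℤ`-module instance. -/
theorem Module.Projective.of_int_module {H : Type*} [AddCommGroup H] {m₁ m₂ : Module ℤ H}
    (h : letI := m₁; Module.Projective ℤ H) : letI := m₂; Module.Projective ℤ H := by
  obtain rfl := Subsingleton.elim m₁ m₂
  exact h

/-- The base change of an additive group does not depend on its `ℤ`-module instance. -/
theorem nonempty_baseChange_int_equiv (R : Type*) [CommRing R] {H : Type*} [AddCommGroup H]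
    {m₁ m₂ : Module ℤ H} :
    Nonempty ((letI := m₁; R ⊗[ℤ] H) ≃ₗ[R] (letI := m₂; R ⊗[ℤ] H)) := by
  obtain rfl := Subsingleton.elim m₁ m₂
  exact ⟨.refl _ _⟩

/-- Universal-coefficients consequence: for a chain complex `C` of free `ℤ`-modules,
if `H_n(C)` is a free `ℤ`-module, then the `(n+1)`-st homology of `C ⊗_ℤ R`
(the complex with components `R ⊗_ℤ C_k` and differentials `id_R ⊗ ∂_k`) is isomorphic,
as an `R`-module, to `H_{n+1}(C) ⊗_ℤ R`. -/
theorem homology_baseChange_of_free_homology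
    {C : ℕ → Type} [∀ k, AddCommGroup (C k)] [∀ k, Module ℤ (C k)]
    [∀ k, Module.Free ℤ (C k)]
    (d : ∀ k, C (k + 1) →ₗ[ℤ] C k) (hd : ∀ k, d k ∘ₗ d (k + 1) = 0)
    (R : Type) [CommRing R] (n : ℕ)
    (hfree : Module.Free ℤ (chainHomology d n)) :
    Nonempty
      (chainHomology (C := fun k => R ⊗[ℤ] C k) (fun k => LinearMap.baseChange R (d k)) (n + 1) ≃ₗ[R]
        R ⊗[ℤ] chainHomology d (n + 1)) := by
  have hhom : Module.Projective ℤ (chainHomology d n) := .of_free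
  obtain ⟨r, hr⟩ := (d n).exists_comp_comp_self_eq (chainCycles d n) (range_le_chainCycles d hd n)
    (LinearMap.range (d n)).projective_of_isPrincipalIdealRing
    (projective_quotient_chainCycles d n) (.of_int_module hhom)
  obtain ⟨π, hsurj, hker⟩ :=
    exists_baseChange_homology_projection (d (n + 1)) (d n) (hd n) r hr R
  obtain ⟨e⟩ := nonempty_homology_equiv_of_surjective ((d (n + 1)).baseChange R)
    ((d n).baseChange R) π hsurj hker
  exact ⟨e.trans (nonempty_baseChange_int_equiv R).some⟩
end

section
/- Let C be a chain complex of free ℤ-modules indexed by ℕ whose zeroth homology H₀(C) is a free ℤ-module, and let R be a commutative ring. Then the first homology of the complex C ⊗_ℤ R is isomorphic, as an R-module, to H₁(C) ⊗_ℤ R. -/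
open TensorProduct

/-- A linear map into a projective module with projective cokernel has a generalized inverse. -/
theorem LinearMap.exists_comp_comp_eq_self_of_projective_quotient_range
    {A M N : Type*} [CommRing A] [AddCommGroup M] [Module A M] [AddCommGroup N] [Module A N]
    [Module.Projective A N] (f : M →ₗ[A] N) [Module.Projective A (N ⧸ LinearMap.range f)] :
    ∃ g : N →ₗ[A] M, f ∘ₗ g ∘ₗ f = f := by
  obtain ⟨s, hs⟩ := Module.projective_lifting_property (LinearMap.range f).mkQ LinearMap.id
    (Submodule.mkQ_surjective _)
  have mem_range (x : N) : x - s ((LinearMap.range f).mkQ x) ∈ LinearMap.range f := by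
    rw [← Submodule.Quotient.mk_eq_zero, ← Submodule.mkQ_apply, map_sub, sub_eq_zero]
    exact (LinearMap.congr_fun hs _).symm
  let π : N →ₗ[A] LinearMap.range f :=
    (LinearMap.id - s ∘ₗ (LinearMap.range f).mkQ).codRestrict _ mem_range
  have π_apply {x : N} (hx : x ∈ LinearMap.range f) : (π x : N) = x := by
    have h0 : (LinearMap.range f).mkQ x = 0 := by simpa using hx
    change x - s ((LinearMap.range f).mkQ x) = x
    rw [h0, map_zero, sub_zero]
  have : Module.Projective A (LinearMap.range f) :=
    Module.Projective.of_split (LinearMap.range f).subtype π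
      (LinearMap.ext fun x => Subtype.ext (π_apply x.2))
  obtain ⟨t, ht⟩ := Module.projective_lifting_property f.rangeRestrict LinearMap.id
    f.surjective_rangeRestrict
  refine ⟨t ∘ₗ π, LinearMap.ext fun x => ?_⟩
  exact (congrArg Subtype.val (LinearMap.congr_fun ht (π (f x)))).trans
    (π_apply (LinearMap.mem_range_self f x))

/-- Zeroth homology is the cokernel of the differential `C₁ → C₀`. -/
def chainHomologyZeroEquiv {A : Type*} [CommRing A] {C : ℕ → Type*} [∀ k, AddCommGroup (C k)]
    [∀ k, Module A (C k)] (d : ∀ k, C (k + 1) →ₗ[A] C k) :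
    chainHomology d 0 ≃ₗ[A] C 0 ⧸ LinearMap.range (d 0) :=
  Submodule.Quotient.equiv ((LinearMap.range (d 0)).comap (chainCycles d 0).subtype)
    (LinearMap.range (d 0)) (Submodule.topEquiv : (⊤ : Submodule A (C 0)) ≃ₗ[A] C 0) <|
      Submodule.ext fun x =>
        ⟨fun ⟨_, hy, hyx⟩ => hyx ▸ hy, fun hx => ⟨⟨x, trivial⟩, hx, rfl⟩⟩

/-- Homology at `M` of `L → M → N` computed from an arbitrary kernel `i : Z → M` of `M → N`. -/
noncomputable def LinearMap.kerQuotientRangeEquivOfExact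
    {A L M N Z : Type*} [CommRing A] [AddCommGroup L] [Module A L] [AddCommGroup M] [Module A M]
    [AddCommGroup N] [Module A N] [AddCommGroup Z] [Module A Z]
    (e : L →ₗ[A] M) (f : M →ₗ[A] N) (i : Z →ₗ[A] M) (b : L →ₗ[A] Z)
    (hi : Function.Injective i) (hif : Function.Exact i f) (hib : i ∘ₗ b = e) :
    (LinearMap.ker f ⧸ (LinearMap.range e).comap (LinearMap.ker f).subtype) ≃ₗ[A]
      Z ⧸ LinearMap.range b :=
  (Submodule.Quotient.equiv _ _
    (LinearEquiv.ofBijective (i.codRestrict (LinearMap.ker f) fun z => hif.apply_apply_eq_zero z)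
      ⟨fun _ _ h => hi (congrArg Subtype.val h), fun x =>
        let ⟨z, hz⟩ := (hif x).mp x.2
        ⟨z, Subtype.ext hz⟩⟩) <| by
    subst hib
    ext x
    constructor
    · rintro ⟨_, ⟨y, rfl⟩, rfl⟩
      exact ⟨y, rfl⟩
    · rintro ⟨y, hy⟩
      exact ⟨b y, ⟨y, rfl⟩, Subtype.ext hy⟩).symm

/-- Base change commutes with cokernels. -/
theorem LinearMap.nonempty_quotient_range_baseChange_equiv
    {A L Z : Type*} [CommRing A] [AddCommGroup L] [Module A L] [AddCommGroup Z] [Module A Z]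
    (R : Type*) [CommRing R] [Algebra A R] (b : L →ₗ[A] Z) :
    Nonempty ((R ⊗[A] Z ⧸ LinearMap.range (b.baseChange R)) ≃ₗ[R]
      R ⊗[A] (Z ⧸ LinearMap.range b)) := by
  let q := (LinearMap.range b).mkQ
  have hq : Function.Surjective q := Submodule.mkQ_surjective _
  have hbq : Function.Exact b q := LinearMap.exact_map_mkQ_range b
  have hker : LinearMap.range (b.baseChange R) = LinearMap.ker (q.baseChange R) :=
    Submodule.ext fun x => (lTensor_exact R hbq hq x).symm
  exact ⟨(Submodule.quotEquivOfEq _ _ hker).trans <|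
    LinearMap.quotKerEquivOfSurjective (q.baseChange R) (LinearMap.lTensor_surjective R hq)⟩

/-- If `C₀` and the zeroth homology are projective, then first homology commutes with
base change. -/
theorem nonempty_chainHomology_one_baseChange_equiv
    {A : Type*} [CommRing A] {C : ℕ → Type*} [∀ k, AddCommGroup (C k)] [∀ k, Module A (C k)]
    [Module.Projective A (C 0)] (d : ∀ k, C (k + 1) →ₗ[A] C k) (hd : d 0 ∘ₗ d 1 = 0)
    (R : Type*) [CommRing R] [Algebra A R] [Module.Projective A (chainHomology d 0)] :
    Nonempty
      (chainHomology (C := fun k => R ⊗[A] C k)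
          (fun k => LinearMap.baseChange R (d k)) 1 ≃ₗ[R]
        R ⊗[A] chainHomology d 1) := by
  have : Module.Projective A (C 0 ⧸ LinearMap.range (d 0)) :=
    Module.Projective.of_equiv (chainHomologyZeroEquiv d)
  obtain ⟨g, hg⟩ := LinearMap.exists_comp_comp_eq_self_of_projective_quotient_range (d 0)
  let Z := LinearMap.ker (d 0)
  let i : Z →ₗ[A] C 1 := Z.subtype
  let p : C 1 →ₗ[A] Z := (LinearMap.id - g ∘ₗ d 0).codRestrict _ fun x => by
    change d 0 (x - g (d 0 x)) = 0
    rw [map_sub, sub_eq_zero]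
    exact (LinearMap.congr_fun hg x).symm
  let b : C 2 →ₗ[A] Z := (d 1).codRestrict _ fun x => LinearMap.congr_fun hd x
  have hpi : p ∘ₗ i = LinearMap.id := LinearMap.ext fun x => Subtype.ext <| by
    have hx : d 0 x = 0 := x.2
    change (x : C 1) - g (d 0 x) = x
    rw [hx, map_zero, sub_zero]
  have hip : i ∘ₗ p = LinearMap.id - g ∘ₗ d 0 := rfl
  have hib : i ∘ₗ b = d 1 := rfl
  have hdi : d 0 ∘ₗ i = 0 := LinearMap.ext fun x => x.2
  have hinj : Function.Injective (i.baseChange R) := by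
    refine Function.LeftInverse.injective (g := p.baseChange R) fun x => ?_
    rw [← LinearMap.comp_apply, ← LinearMap.baseChange_comp, hpi, LinearMap.baseChange_id,
      LinearMap.id_apply]
  have hexact : Function.Exact (i.baseChange R) ((d 0).baseChange R) := by
    refine fun x => ⟨fun hx => ⟨p.baseChange R x, ?_⟩, ?_⟩
    · rw [← LinearMap.comp_apply, ← LinearMap.baseChange_comp, hip, LinearMap.baseChange_sub,
        LinearMap.baseChange_id, LinearMap.baseChange_comp, LinearMap.sub_apply,
        LinearMap.comp_apply, hx, map_zero, sub_zero, LinearMap.id_apply]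
    · rintro ⟨z, rfl⟩
      rw [← LinearMap.comp_apply, ← LinearMap.baseChange_comp, hdi, LinearMap.baseChange_zero,
        LinearMap.zero_apply]
  have hib' : i.baseChange R ∘ₗ b.baseChange R = (d 1).baseChange R := by
    rw [← LinearMap.baseChange_comp, hib]
  have homology_equiv : chainHomology d 1 ≃ₗ[A] Z ⧸ LinearMap.range b :=
    LinearMap.kerQuotientRangeEquivOfExact (d 1) (d 0) i b Z.injective_subtype
      (LinearMap.exact_subtype_ker_map (d 0)) hib
  obtain ⟨coker_equiv⟩ := LinearMap.nonempty_quotient_range_baseChange_equiv R b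
  exact ⟨((LinearMap.kerQuotientRangeEquivOfExact ((d 1).baseChange R) ((d 0).baseChange R)
    (i.baseChange R) (b.baseChange R) hinj hexact hib').trans coker_equiv).trans
      (homology_equiv.symm.baseChange A R _ _)⟩

/-- For a chain complex `C` of free `ℤ`-modules with `H₀(C)` free, the first homology of
`C ⊗_ℤ R` (the complex with components `R ⊗_ℤ C_k` and differentials `id_R ⊗ ∂_k`) is
isomorphic, as an `R`-module, to `H₁(C) ⊗_ℤ R`. -/
theorem first_homology_baseChange_of_free_H0
    {C : ℕ → Type} [∀ k, AddCommGroup (C k)] [∀ k, Module ℤ (C k)]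
    [∀ k, Module.Free ℤ (C k)]
    (d : ∀ k, C (k + 1) →ₗ[ℤ] C k) (hd : ∀ k, d k ∘ₗ d (k + 1) = 0)
    (R : Type) [CommRing R]
    (hfree : Module.Free ℤ (chainHomology d 0)) :
    Nonempty
      (chainHomology (C := fun k => R ⊗[ℤ] C k)
          (fun k => LinearMap.baseChange R (d k)) 1 ≃ₗ[R]
        R ⊗[ℤ] chainHomology d 1) := by
  have projective_of_free (M : Type) [AddCommGroup M] (m₁ m₂ : Module ℤ M)
      (h : @Module.Free ℤ M _ _ m₁) : @Module.Projective ℤ _ M _ m₂ := by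
    obtain rfl : m₁ = m₂ := Subsingleton.elim _ _
    exact @Module.Projective.of_free _ _ _ _ _ h
  have equiv_congr (X M : Type) [AddCommGroup X] [Module R X] [AddCommGroup M]
      (m₁ m₂ : Module ℤ M) (h : letI := m₁; Nonempty (X ≃ₗ[R] R ⊗[ℤ] M)) :
      letI := m₂; Nonempty (X ≃ₗ[R] R ⊗[ℤ] M) := by
    obtain rfl : m₁ = m₂ := Subsingleton.elim _ _
    exact h
  exact equiv_congr _ _ _ _ <| @nonempty_chainHomology_one_baseChange_equiv
    ℤ _ C _ _ _ d (hd 0) R _ _ (projective_of_free _ _ _ hfree)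
end
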